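/- Let p be an odd prime and K a finite field extension of ℚ_p. Then the number of isometry classes of nondegenerate quadratic forms of degree n over K is 4 if n = 1, 7 if n = 2, and 8 if n ≥ 3. -/

import Mathlib

/-- A quadratic form of degree `m` over `K`: a quadratic form on `Fin m → K`. -/
abbrev QF (K : Type) [Field K] (m : ℕ) : Type := QuadraticForm K (Fin m → K)

/-- Two quadratic forms are isometric if there is a linear equivalence of the underlying
spaces carrying one to the other. -/
def QIsom {K : Type} [Field K] {M M' : Type} [AddCommGroup M] [Module K M]
    [AddCommGroup M'] [Module K M'] (Q : QuadraticForm K M) (Q' : QuadraticForm K M') : Prop :=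
  ∃ φ : M ≃ₗ[K] M', ∀ x, Q' (φ x) = Q x

/-- The hyperbolic plane `(x, y) ↦ x * y` on `K²`. -/
noncomputable def HypForm (K : Type) [Field K] : QuadraticForm K (K × K) :=
  QuadraticMap.linMulLin (LinearMap.fst K K K) (LinearMap.snd K K K)

/-- Orthogonal sum of `m` copies of the hyperbolic plane. -/
noncomputable def HypSum (K : Type) [Field K] (m : ℕ) : QuadraticForm K (Fin m → K × K) :=
  QuadraticMap.pi (fun _ : Fin m => HypForm K)

/-- Witt equivalence of quadratic forms. -/
def WittEquiv {K : Type} [Field K] {M M' : Type} [AddCommGroup M] [Module K M]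
    [AddCommGroup M'] [Module K M'] (Q : QuadraticForm K M) (Q' : QuadraticForm K M') : Prop :=
  ∃ a b : ℕ, QIsom (Q.prod (HypSum K a)) (Q'.prod (HypSum K b))

/-- A quadratic form is nondegenerate if its polar bilinear form is nondegenerate. -/
def QNondeg {K : Type} [Field K] {M : Type} [AddCommGroup M] [Module K M]
    (Q : QuadraticForm K M) : Prop :=
  ∀ v, (∀ w, QuadraticMap.polar (⇑Q) v w = 0) → v = 0

/-- The diagonal quadratic form `⟨a₁, …, a_m⟩`. -/
noncomputable def diagQF {K : Type} [Field K] {m : ℕ} (r : Fin m → Kˣ) : QF K m :=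
  QuadraticMap.weightedSumSquares K (fun i => (r i : K))

/-- The Lie algebra `so(Q)`. -/
def soSet {K : Type} [Field K] {M : Type} [AddCommGroup M] [Module K M]
    (Q : QuadraticForm K M) : Set (Module.End K M) :=
  {X | ∀ v w, QuadraticMap.polar (⇑Q) (X v) w + QuadraticMap.polar (⇑Q) v (X w) = 0}

/-- Membership in the orthogonal group `O(Q)` (as invertible linear maps preserving `Q`). -/
def InO {K : Type} [Field K] {M : Type} [AddCommGroup M] [Module K M]
    (Q : QuadraticForm K M) (g : M ≃ₗ[K] M) : Prop :=
  ∀ v, Q (g v) = Q v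

/-- Membership in the special orthogonal group `SO(Q)`. -/
def InSO {K : Type} [Field K] {M : Type} [AddCommGroup M] [Module K M]
    (Q : QuadraticForm K M) (g : M ≃ₗ[K] M) : Prop :=
  InO Q g ∧ LinearMap.det (g : M →ₗ[K] M) = 1

/-- A nilpotent endomorphism has Jordan type `λ` when `dim ker (X^i) = Σ_j min(i, λ_j)`. -/
def HasJordanType {K : Type} [Field K] {M : Type} [AddCommGroup M] [Module K M]
    {n : ℕ} (X : Module.End K M) (lam : Nat.Partition n) : Prop :=
  ∀ i : ℕ, Module.finrank K (LinearMap.ker (X ^ i)) = (lam.parts.map (fun part => min i part)).sum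

/-- `Λ(n)`: partitions of `n` in which every even part has even multiplicity. -/
def LambdaSet (n : ℕ) : Set (Nat.Partition n) :=
  {lam | ∀ j : ℕ, Even j → Even (lam.parts.count j)}



section LocalPart

open scoped NormedField Valued

lemma norm_sub_le_max' {K : Type} [NontriviallyNormedField K] [IsUltrametricDist K] (x y : K) :
    ‖x - y‖ ≤ max ‖x‖ ‖y‖ := by
  simpa [sub_eq_add_neg] using IsUltrametricDist.norm_add_le_max x (-y)

lemma sq_of_near_one {K : Type} [NontriviallyNormedField K] [IsUltrametricDist K] [ProperSpace K]
    (h2 : ‖(2 : K)‖ = 1) (x : K) (hx : ‖x - 1‖ < 1) : ∃ y : K, x = y ^ 2 := by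
  have h20 : (2 : K) ≠ 0 := by intro h; simp [h] at h2
  obtain ⟨y, hy, hmin⟩ := (isCompact_closedBall (1 : K) ‖x - 1‖).exists_isMinOn
    ⟨1, by simp⟩ (f := fun y => ‖y ^ 2 - x‖) (by fun_prop)
  rw [mem_closedBall_iff_norm] at hy
  have hn1 : ∀ y : K, ‖y - 1‖ ≤ ‖x - 1‖ → ‖y‖ = 1 := by
    intro y hy
    have := IsUltrametricDist.norm_add_eq_max_of_norm_ne_norm (x := y - 1) (y := 1)
      (by simp; linarith)
    simp at this
    rw [this]; exact max_eq_right (by linarith)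
  have hy1 := hn1 y hy
  have hy0 : y ≠ 0 := by intro h; simp [h] at hy1
  set δ := y ^ 2 - x with hδ
  by_cases h0 : δ = 0
  · exact ⟨y, by linear_combination hδ - h0⟩
  exfalso
  have hδr : ‖δ‖ ≤ ‖x - 1‖ := by
    have : δ = (y - 1) * (y + 1) - (x - 1) := by rw [hδ]; ring
    rw [this]
    refine (norm_sub_le_max' _ _).trans (max_le ?_ le_rfl)
    rw [norm_mul]
    have : ‖y + 1‖ ≤ 1 := (IsUltrametricDist.norm_add_le_max _ _).trans (by simp [hy1])
    nlinarith [norm_nonneg (y - 1), norm_nonneg (y+1)]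
  have key := hmin (a := y - δ / (2 * y)) (by
    rw [mem_closedBall_iff_norm]
    have : y - δ / (2 * y) - 1 = (y - 1) - δ / (2 * y) := by ring
    rw [this]
    refine (norm_sub_le_max' _ _).trans (max_le hy ?_)
    simpa [h2, hy1] using hδr)
  simp only [Set.mem_ofPred_eq] at key
  have e : (y - δ / (2 * y)) ^ 2 - x = δ ^ 2 / (2 * y) ^ 2 := by
    have : x = y ^ 2 - δ := by rw [hδ]; ring
    rw [this]; field_simp; ring
  rw [e] at key
  simp [h2, hy1] at key
  rw [← hδ] at key
  have : 0 < ‖δ‖ := norm_pos_iff.2 h0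
  nlinarith

lemma resid_eq {K : Type} [NontriviallyNormedField K] [IsUltrametricDist K] (a : 𝒪[K]) :
    IsLocalRing.residue 𝒪[K] a = 0 ↔ ‖(a : K)‖ < 1 := by
  rw [IsLocalRing.residue_eq_zero_iff, IsLocalRing.mem_maximalIdeal, mem_nonunits_iff,
    Valued.integer.isUnit_iff_norm_eq_one]
  have := Valued.integer.norm_le_one a
  exact ⟨fun h => lt_of_le_of_ne this h, fun h => ne_of_lt h⟩

lemma finite_resid {K : Type} [NontriviallyNormedField K] [IsUltrametricDist K] [ProperSpace K] :
    Finite 𝓀[K] := by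
  obtain ⟨t, ht, hcov⟩ := Metric.totallyBounded_iff.1
    (isCompact_closedBall (0:K) 1).totallyBounded 1 one_pos
  have : ∀ a : 𝓀[K], ∃ x : 𝒪[K], ∃ y : t, IsLocalRing.residue 𝒪[K] x = a ∧ ‖(x : K) - y‖ < 1 := by
    intro a
    obtain ⟨x, rfl⟩ := IsLocalRing.residue_surjective a
    have := hcov (show (x : K) ∈ Metric.closedBall (0:K) 1 by
      simpa using Valued.integer.norm_le_one x)
    simp only [Set.mem_iUnion, mem_ball_iff_norm] at this
    obtain ⟨y, hy, h⟩ := this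
    exact ⟨x, ⟨y, hy⟩, rfl, h⟩
  choose f g hf hg using this
  have : Finite t := ht
  refine Finite.of_injective g fun a b hab => ?_
  rw [← hf a, ← hf b, ← sub_eq_zero, ← map_sub, resid_eq]
  have h1 := hg a
  have h2 := hg b
  rw [← hab] at h2
  have : ((f a - f b : 𝒪[K]) : K) = ((f a : K) - g a) - (f b - g a) := by push_cast; ring
  rw [this]
  exact (norm_sub_le_max' _ _).trans_lt (max_lt h1 h2)

lemma unif {K : Type} [NontriviallyNormedField K] [IsUltrametricDist K] [ProperSpace K] :
    ∃ π : K, 0 < ‖π‖ ∧ ‖π‖ < 1 ∧ ∀ x : K, x ≠ 0 → ∃ n : ℤ, ‖x‖ = ‖π‖ ^ n := by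
  have hc : IsCompact (Metric.ball (0:K) 1) :=
    (isCompact_closedBall (0:K) 1).of_isClosed_subset (IsUltrametricDist.isClosed_ball 0 1)
      Metric.ball_subset_closedBall
  obtain ⟨π, hπ, hmax⟩ := hc.exists_isMaxOn ⟨0, by simp⟩ (f := fun y => ‖y‖) (by fun_prop)
  simp at hπ
  obtain ⟨z, hz0, hz1⟩ := NormedField.exists_norm_lt_one K
  have hpos : 0 < ‖π‖ := hz0.trans_le (hmax (a := z) (by simpa using hz1))
  refine ⟨π, hpos, hπ, fun x hx => ?_⟩
  obtain ⟨n, hn1, hn2⟩ := exists_mem_Ico_zpow (norm_pos_iff.2 hx) ((one_lt_inv₀ hpos).2 hπ)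
  rw [zpow_add_one₀ (by positivity)] at hn2
  refine ⟨-n, ?_⟩
  rw [zpow_neg, ← inv_zpow]
  refine le_antisymm ?_ hn1
  by_contra! hlt
  have h1 := hmax (a := x⁻¹ * (π⁻¹) ^ n) (by
    simp only [mem_ball_zero_iff, norm_mul, norm_inv, norm_zpow]
    rw [inv_mul_lt_iff₀ (norm_pos_iff.2 hx)]; simpa using hlt)
  simp only [norm_mul, norm_inv, norm_zpow, Set.mem_ofPred_eq] at h1
  rw [inv_mul_le_iff₀ (norm_pos_iff.2 hx)] at h1
  have h3 : ‖x‖ * ‖π‖ < ‖π‖⁻¹ ^ n := by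
    calc _ < (‖π‖⁻¹ ^ n * ‖π‖⁻¹) * ‖π‖ := by gcongr
      _ = _ := by field_simp
  linarith

/-- The arithmetic facts about a local field needed in the classification. -/
structure LocData (K : Type) [Field K] (u π : K) : Prop where
  two : (2 : K) ≠ 0
  cov : ∀ x : K, x ≠ 0 → ∃ t : K, t ≠ 0 ∧
    (x = t ^ 2 ∨ x = u * t ^ 2 ∨ x = π * t ^ 2 ∨ x = u * π * t ^ 2)
  aniso : ∀ x y z w : K, x ^ 2 - u * y ^ 2 = π * (z ^ 2 - u * w ^ 2) →
    x = 0 ∧ y = 0 ∧ z = 0 ∧ w = 0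
  neg_one : ∃ t : K, -1 = t ^ 2 ∨ -1 = u * t ^ 2
  sum_sq : ∃ a b : K, a ^ 2 + b ^ 2 = u

lemma nonsq_mul {k : Type} [Field k] [Finite k] (a b : k) (ha : ¬ IsSquare a) (hb : ¬ IsSquare b) :
    IsSquare (a * b) := by
  classical
  have := Fintype.ofFinite k
  rw [← quadraticChar_neg_one_iff_not_isSquare] at ha hb
  have h : a * b ≠ 0 := by
    intro h
    rcases mul_eq_zero.1 h with h | h <;> simp [h] at ha hb
  rw [← quadraticChar_one_iff_isSquare h, map_mul, ha, hb]; norm_num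

lemma sum_two_sq {k : Type} [Field k] [Finite k] (h2 : (2 : k) ≠ 0) (u : k) :
    ∃ a b : k, a ^ 2 + b ^ 2 = u := by
  have := Fintype.ofFinite k
  have hc : ringChar k ≠ 2 := by
    intro h
    apply h2
    have := ringChar.Nat.cast_ringChar (R := k)
    rw [h] at this; exact_mod_cast this
  obtain ⟨a, b, h⟩ := FiniteField.exists_root_sum_quadratic (R := k) (f := Polynomial.X ^ 2)
    (g := Polynomial.X ^ 2 - Polynomial.C u) (Polynomial.degree_X_pow 2)
    (Polynomial.degree_X_pow_sub_C (by decide) _) (FiniteField.odd_card_of_char_ne_two hc)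
  simp at h
  exact ⟨a, b, by linear_combination h⟩

theorem locData_of_normed {K : Type} [NontriviallyNormedField K] [IsUltrametricDist K]
    [ProperSpace K] (h2 : ‖(2 : K)‖ = 1) : ∃ u π : K, LocData K u π := by
  have := finite_resid (K := K)
  obtain ⟨π, hπ0, hπ1, hπ⟩ := unif (K := K)
  set r := IsLocalRing.residue 𝒪[K] with hr
  have hr0 : ∀ a : 𝒪[K], r a = 0 ↔ ‖(a : K)‖ < 1 := resid_eq
  have hr1 : ∀ a : 𝒪[K], r a ≠ 0 → ‖(a : K)‖ = 1 := fun a ha =>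
    le_antisymm (Valued.integer.mem_iff.1 a.2) (not_lt.1 fun h => ha ((hr0 a).2 h))
  have h20 : (2 : K) ≠ 0 := by intro h; simp [h] at h2
  have h2k : (2 : 𝓀[K]) ≠ 0 := by
    intro h
    have h3 : r 2 = 0 := (map_ofNat r 2).trans h
    rw [hr0] at h3
    have : ((2 : 𝒪[K]) : K) = 2 := rfl
    rw [this, h2] at h3
    exact lt_irrefl _ h3
  have hsq : ∀ a : 𝒪[K], r a ≠ 0 → IsSquare (r a) → ∃ y : K, (a : K) = y ^ 2 := by
    rintro a ha ⟨c, hc⟩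
    obtain ⟨b, rfl⟩ := IsLocalRing.residue_surjective c
    have hb : r b ≠ 0 := by intro h; rw [← hr, h] at hc; simp [hc] at ha
    have hb1 := hr1 b hb
    have hb0 : (b : K) ≠ 0 := by intro h; simp [h] at hb1
    obtain ⟨y, hy⟩ := sq_of_near_one h2 ((a : K) / b ^ 2) (by
      have : (a : K) / b ^ 2 - 1 = ((a - b * b : 𝒪[K]) : K) / b ^ 2 := by
        push_cast; field_simp
      rw [this, norm_div, norm_pow, hb1]
      simp only [one_pow, div_one]
      rw [← hr0, map_sub, map_mul, hc, sub_self])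
    exact ⟨b * y, by rw [mul_pow, ← hy]; field_simp⟩
  obtain ⟨ub, hub⟩ := FiniteField.exists_nonsquare (F := 𝓀[K]) (by
    intro h
    apply h2k
    have := ringChar.Nat.cast_ringChar (R := 𝓀[K])
    rw [h] at this; exact_mod_cast this)
  obtain ⟨u, rfl⟩ := IsLocalRing.residue_surjective ub
  rw [← hr] at hub
  have hu0 : r u ≠ 0 := by intro h; rw [h] at hub; simp at hub
  have hu1 := hr1 u hu0
  have hu00 : (u : K) ≠ 0 := by intro h; simp [h] at hu1
  have hunit : ∀ w : K, ‖w‖ = 1 → ∃ t : K, w = t ^ 2 ∨ w = u * t ^ 2 := by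
    intro w hw
    set a : 𝒪[K] := ⟨w, Valued.integer.mem_iff.2 hw.le⟩ with ha
    have ha0 : r a ≠ 0 := by rw [Ne, hr0]; simp [ha, hw]
    by_cases h : IsSquare (r a)
    · obtain ⟨y, hy⟩ := hsq a ha0 h
      exact ⟨y, Or.inl hy⟩
    · obtain ⟨y, hy⟩ := hsq (a * u) (by rw [map_mul]; exact mul_ne_zero ha0 hu0)
        (by rw [map_mul]; exact nonsq_mul _ _ h hub)
      refine ⟨y / u, Or.inr ?_⟩
      have : w * u = y ^ 2 := by rw [← hy]; rfl
      field_simp; exact this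
  have hnorm : ∀ x y : K, (x ≠ 0 ∨ y ≠ 0) → ∃ s : K, s ≠ 0 ∧ ‖x ^ 2 - u * y ^ 2‖ = ‖s‖ ^ 2 := by
    intro x y hxy
    by_cases hne : ‖x‖ = ‖y‖
    · have hy0 : y ≠ 0 := by
        rintro rfl
        simp at hne
        simp [hne] at hxy
      refine ⟨y, hy0, ?_⟩
      have hy1 : ‖y‖ ≠ 0 := norm_ne_zero_iff.2 hy0
      have ht : ‖x / y‖ = 1 := by rw [norm_div, hne]; field_simp
      set t : 𝒪[K] := ⟨x / y, Valued.integer.mem_iff.2 ht.le⟩ with htd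
      have h1 : ‖((t * t - u : 𝒪[K]) : K)‖ = 1 := by
        apply hr1
        intro h
        rw [map_sub, map_mul, sub_eq_zero] at h
        exact hub ⟨_, h.symm⟩
      have : x ^ 2 - u * y ^ 2 = ((t * t - u : 𝒪[K]) : K) * y ^ 2 := by
        simp only [htd]; push_cast; field_simp
      rw [this, norm_mul, h1, norm_pow, one_mul]
    · have hm := IsUltrametricDist.norm_add_eq_max_of_norm_ne_norm (x := x ^ 2) (y := - (u * y ^ 2))
        (by
          rw [norm_neg, norm_mul, hu1, norm_pow, norm_pow, one_mul]
          intro h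
          exact hne ((pow_left_inj₀ (norm_nonneg _) (norm_nonneg _) two_ne_zero).1 h))
      rw [← sub_eq_add_neg, norm_neg, norm_mul, hu1, norm_pow, norm_pow, one_mul] at hm
      rcases lt_or_gt_of_ne hne with h | h
      · refine ⟨y, norm_pos_iff.1 ((norm_nonneg x).trans_lt h), ?_⟩
        rw [hm, max_eq_right]; gcongr
      · refine ⟨x, norm_pos_iff.1 ((norm_nonneg y).trans_lt h), ?_⟩
        rw [hm, max_eq_left]; gcongr
  have hπ00 : π ≠ 0 := norm_pos_iff.1 hπ0
  refine ⟨u, π, h20, ?_, ?_, ?_, ?_⟩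
  · intro x hx
    obtain ⟨n, hn⟩ := hπ x hx
    obtain ⟨t, ht⟩ := hunit (x / π ^ n) (by
      rw [norm_div, norm_zpow, hn]; exact div_self (by positivity))
    have hx' : x = (x / π ^ n) * π ^ n := by field_simp
    have ht0 : t ≠ 0 := by
      rintro rfl
      apply hx
      rw [hx']
      rcases ht with h | h <;> rw [h] <;> simp
    rcases Int.even_or_odd' n with ⟨m, hm | hm⟩
    · refine ⟨t * π ^ m, by positivity, ?_⟩
      have e : π ^ n = (π ^ m) ^ 2 := by rw [hm, mul_comm, zpow_mul]; norm_cast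
      rcases ht with h | h
      · left; rw [hx', h, e]; ring
      · right; left; rw [hx', h, e]; ring
    · refine ⟨t * π ^ m, by positivity, ?_⟩
      have e : π ^ n = (π ^ m) ^ 2 * π := by
        rw [hm, zpow_add_one₀ hπ00, mul_comm 2 m, zpow_mul]; norm_cast
      rcases ht with h | h
      · right; right; left; rw [hx', h, e]; ring
      · right; right; right; rw [hx', h, e]; ring
  · intro x y z w h
    have hz : ∀ x y : K, x ^ 2 - u * y ^ 2 = 0 → x = 0 ∧ y = 0 := by
      intro x y h
      by_contra! hc
      obtain ⟨s, hs, e⟩ := hnorm x y (by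
        by_cases hx : x = 0
        · exact Or.inr (hc hx)
        · exact Or.inl hx)
      rw [h] at e
      simp at e
      exact hs (norm_eq_zero.1 ((pow_eq_zero_iff two_ne_zero).1 e.symm))
    by_cases hzw : z ≠ 0 ∨ w ≠ 0
    · exfalso
      obtain ⟨s, hs, e⟩ := hnorm z w hzw
      have hxy : x ≠ 0 ∨ y ≠ 0 := by
        by_contra! hc
        rw [hc.1, hc.2] at h
        have : z ^ 2 - u * w ^ 2 = 0 := by
          simp at h
          exact h.resolve_left hπ00
        obtain ⟨h1, h2⟩ := hz _ _ this
        simp [h1, h2] at hzw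
      obtain ⟨s', hs', e'⟩ := hnorm x y hxy
      rw [h, norm_mul, e] at e'
      obtain ⟨n, hn⟩ := hπ s hs
      obtain ⟨m, hm⟩ := hπ s' hs'
      rw [hn, hm] at e'
      have h1 : ‖π‖ ^ (1 + n * 2) = ‖π‖ ^ (m * 2) := by
        rw [zpow_add₀ hπ0.ne', zpow_mul, zpow_mul, zpow_one]; exact_mod_cast e'
      have := zpow_right_injective₀ hπ0 hπ1.ne h1
      omega
    · push Not at hzw
      obtain ⟨rfl, rfl⟩ := hzw
      obtain ⟨h1, h2⟩ := hz x y (by rw [h]; simp)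
      exact ⟨h1, h2, rfl, rfl⟩
  · exact hunit (-1) (by simp)
  · obtain ⟨a, b, hab⟩ := sum_two_sq h2k (r u)
    have key : ∀ a b : 𝓀[K], a ^ 2 + b ^ 2 = r u → a ≠ 0 → ∃ a b : K, a ^ 2 + b ^ 2 = u := by
      intro a b hab ha
      obtain ⟨b, rfl⟩ := IsLocalRing.residue_surjective b
      have e : r (u - b ^ 2) = a ^ 2 := by
        rw [map_sub, map_pow, ← hab]; ring
      obtain ⟨y, hy⟩ := hsq (u - b ^ 2) (by rw [e]; positivity) (by rw [e]; exact ⟨a, sq a⟩)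
      refine ⟨y, b, ?_⟩
      rw [← hy]; push_cast; ring
    by_cases ha : a = 0
    · refine key b a (by rw [add_comm]; exact hab) ?_
      rintro rfl
      apply hu0
      rw [← hab, ha]; ring
    · exact key a b hab ha

theorem locData_padic (p : ℕ) [Fact p.Prime] (hp : p ≠ 2) (K : Type) [Field K]
    [Algebra ℚ_[p] K] [FiniteDimensional ℚ_[p] K] : ∃ u π : K, LocData K u π := by
  have : Algebra.IsAlgebraic ℚ_[p] K := Algebra.IsAlgebraic.of_finite _ _
  let _ : NontriviallyNormedField K := spectralNorm.nontriviallyNormedField ℚ_[p] K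
  let _ : NormedSpace ℚ_[p] K := spectralNorm.normedSpace ℚ_[p] K
  have : ProperSpace K := FiniteDimensional.proper ℚ_[p] K
  have : IsUltrametricDist K := IsUltrametricDist.isUltrametricDist_of_isNonarchimedean_norm
    (isNonarchimedean_spectralNorm (K := ℚ_[p]) (L := K))
  refine locData_of_normed (K := K) ?_
  have h : ‖(algebraMap ℚ_[p] K 2)‖ = ‖(2 : ℚ_[p])‖ := spectralNorm_extends 2
  rw [map_ofNat] at h
  rw [h]
  have h3 : ‖((2 : ℕ) : ℚ_[p])‖ = 1 := by
    rw [Padic.norm_natCast_eq_one_iff]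
    exact (Nat.coprime_primes Fact.out Nat.prime_two).2 hp
  exact_mod_cast h3

end LocalPart

section QFpart

variable {K : Type} [Field K]

lemma QIsom.refl' {M : Type} [AddCommGroup M] [Module K M] (Q : QuadraticForm K M) : QIsom Q Q :=
  ⟨LinearEquiv.refl K M, fun _ => rfl⟩

lemma QIsom.symm' {M M' : Type} [AddCommGroup M] [Module K M] [AddCommGroup M'] [Module K M']
    {Q : QuadraticForm K M} {Q' : QuadraticForm K M'} (h : QIsom Q Q') : QIsom Q' Q := by
  obtain ⟨φ, hφ⟩ := h
  exact ⟨φ.symm, fun x => by rw [← hφ]; simp⟩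

lemma QIsom.trans' {M M' M'' : Type} [AddCommGroup M] [Module K M] [AddCommGroup M'] [Module K M']
    [AddCommGroup M''] [Module K M'']
    {Q : QuadraticForm K M} {Q' : QuadraticForm K M'} {Q'' : QuadraticForm K M''}
    (h : QIsom Q Q') (h' : QIsom Q' Q'') : QIsom Q Q'' := by
  obtain ⟨φ, hφ⟩ := h
  obtain ⟨ψ, hψ⟩ := h'
  exact ⟨φ.trans ψ, fun x => by simp [hφ, hψ]⟩

lemma QIsom.nondeg {M M' : Type} [AddCommGroup M] [Module K M] [AddCommGroup M'] [Module K M']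
    {Q : QuadraticForm K M} {Q' : QuadraticForm K M'} (h : QIsom Q Q') (hQ : QNondeg Q) :
    QNondeg Q' := by
  obtain ⟨φ, hφ⟩ := h.symm'
  intro v hv
  have : φ v = 0 := by
    apply hQ
    intro w
    obtain ⟨w, rfl⟩ := φ.surjective w
    have := hv w
    simpa [QuadraticMap.polar, ← map_add, hφ] using this
  simpa using this

/-- The form `a x₀² + Q(x₁, …, xₙ)`. -/
noncomputable def consQ {n : ℕ} (a : K) (Q : QF K n) : QF K (n + 1) :=
  a • QuadraticMap.sq.comp (LinearMap.proj 0) + Q.comp (LinearMap.funLeft K K Fin.succ)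

lemma consQ_apply {n : ℕ} (a : K) (Q : QF K n) (x : Fin (n + 1) → K) :
    consQ a Q x = a * x 0 ^ 2 + Q (fun i => x i.succ) := by
  simp [consQ, sq]; rfl

lemma consQ_cons {n : ℕ} (a : K) (Q : QF K n) (s : K) (x : Fin n → K) :
    consQ a Q (Fin.cons s x) = a * s ^ 2 + Q x := by
  simp [consQ_apply]

lemma cons_surj {n : ℕ} (x : Fin (n + 1) → K) : ∃ s y, x = (Fin.cons s y : Fin (n + 1) → K) :=
  ⟨x 0, Fin.tail x, (Fin.cons_self_tail x).symm⟩

lemma cons_add' {n : ℕ} (s t : K) (x y : Fin n → K) :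
    (Fin.cons s x + Fin.cons t y : Fin (n + 1) → K) = Fin.cons (s + t) (x + y) := by
  ext i; refine Fin.cases ?_ (fun j => ?_) i <;> simp

lemma consQ_polar {n : ℕ} (a : K) (Q : QF K n) (s t : K) (x y : Fin n → K) :
    QuadraticMap.polar (consQ a Q) (Fin.cons s x) (Fin.cons t y)
      = 2 * a * s * t + QuadraticMap.polar Q x y := by
  simp only [QuadraticMap.polar, cons_add', consQ_cons]; ring

lemma consQ_nondeg_iff (h2 : (2 : K) ≠ 0) {n : ℕ} {a : K} (ha : a ≠ 0) (Q : QF K n) :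
    QNondeg (consQ a Q) ↔ QNondeg Q := by
  constructor
  · intro h v hv
    have := h (Fin.cons 0 v) (fun w => by
      obtain ⟨t, y, rfl⟩ := cons_surj w
      rw [consQ_polar, hv]; ring)
    ext i
    simpa using congrFun this i.succ
  · intro h v hv
    obtain ⟨s, x, rfl⟩ := cons_surj v
    have hs : s = 0 := by
      have := hv (Fin.cons 1 0)
      rw [consQ_polar] at this
      simpa [QuadraticMap.polar, h2, ha] using this
    have hx : x = 0 := h x (fun w => by
      have := hv (Fin.cons 0 w)
      rw [consQ_polar] at this
      simpa using this)
    subst hs hx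
    ext i; refine Fin.cases ?_ (fun j => ?_) i <;> simp

/-- `id × φ` on `Fin (n+1) → K`. -/
lemma consQ_congr {n : ℕ} (a : K) {Q Q' : QF K n} (h : QIsom Q Q') :
    QIsom (consQ a Q) (consQ a Q') := by
  obtain ⟨φ, hφ⟩ := h
  let e := Fin.consLinearEquiv K (fun _ : Fin (n + 1) => K)
  refine ⟨e.symm.trans (((LinearEquiv.refl K K).prodCongr φ).trans e), fun x => ?_⟩
  obtain ⟨s, x, rfl⟩ := cons_surj x
  have : e.symm (Fin.cons s x) = (s, x) := by
    rw [LinearEquiv.symm_apply_eq]; rfl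
  simp only [LinearEquiv.trans_apply, this]
  change consQ a Q' (Fin.cons s (φ x)) = _
  rw [consQ_cons, consQ_cons, hφ]

lemma consQ_scale {n : ℕ} (a : K) {t : K} (ht : t ≠ 0) (Q : QF K n) :
    QIsom (consQ (a * t ^ 2) Q) (consQ a Q) := by
  let e := Fin.consLinearEquiv K (fun _ : Fin (n + 1) => K)
  refine ⟨e.symm.trans (((LinearEquiv.smulOfNeZero K K t ht).prodCongr (.refl K _)).trans e),
    fun x => ?_⟩
  obtain ⟨s, x, rfl⟩ := cons_surj x
  have : e.symm (Fin.cons s x) = (s, x) := by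
    rw [LinearEquiv.symm_apply_eq]; rfl
  simp only [LinearEquiv.trans_apply, this]
  change consQ a Q (Fin.cons (t * s) x) = _
  rw [consQ_cons, consQ_cons]; ring

lemma qisom_of_injective {n : ℕ} {Q Q' : QF K n} (f : (Fin n → K) →ₗ[K] (Fin n → K))
    (hf : Function.Injective f) (h : ∀ x, Q' (f x) = Q x) : QIsom Q Q' :=
  ⟨LinearEquiv.ofInjectiveEndo f hf, fun x => by simpa using h x⟩

lemma binary {n : ℕ} {a b e x y : K} (he : a * x ^ 2 + b * y ^ 2 = e) (he0 : e ≠ 0) (Q : QF K n) :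
    QIsom (consQ a (consQ b Q)) (consQ e (consQ (a * b * e) Q)) := by
  apply QIsom.symm'
  let f : (Fin (n + 2) → K) →ₗ[K] (Fin (n + 2) → K) :=
    { toFun := fun v => Fin.cons (x * v 0 - b * y * v 1)
        (Fin.cons (y * v 0 + a * x * v 1) (fun i => v i.succ.succ))
      map_add' := by
        intro v w
        rw [cons_add', cons_add']
        congr 1
        · simp; ring
        congr 1
        simp; ring
      map_smul' := by
        intro c v
        ext i
        refine Fin.cases ?_ (fun j => ?_) i
        · simp; ring
        refine Fin.cases ?_ (fun j => ?_) j
        · simp; ring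
        · simp }
  refine qisom_of_injective f ?_ ?_
  · rw [← LinearMap.ker_eq_bot, LinearMap.ker_eq_bot']
    intro v hv
    have h0 : x * v 0 - b * y * v 1 = 0 := congrFun hv 0
    have h1 : y * v 0 + a * x * v 1 = 0 := congrFun hv 1
    have h3 : ∀ i : Fin n, v i.succ.succ = 0 := fun i => congrFun hv i.succ.succ
    have e0 : e * v 0 = 0 := by rw [← he]; linear_combination a * x * h0 + b * y * h1
    have e1 : e * v 1 = 0 := by rw [← he]; linear_combination -y * h0 + x * h1
    ext i
    refine Fin.cases ?_ (fun j => ?_) i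
    · simpa [he0] using e0
    refine Fin.cases ?_ (fun j => ?_) j
    · simpa [he0] using e1
    · exact h3 j
  · intro v
    change consQ a (consQ b Q) (Fin.cons (x * v 0 - b * y * v 1)
        (Fin.cons (y * v 0 + a * x * v 1) (fun i => v i.succ.succ))) = _
    rw [consQ_cons, consQ_cons, consQ_apply, consQ_apply, ← he]
    simp only [Fin.succ_zero_eq_one]
    ring

lemma swapQ {n : ℕ} {a b : K} (ha : a ≠ 0) (hb : b ≠ 0) (Q : QF K n) :
    QIsom (consQ a (consQ b Q)) (consQ b (consQ a Q)) := by
  refine (binary (x := 0) (y := 1) (e := b) (by simp) hb Q).trans' ?_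
  have : a * b * b = a * b ^ 2 := by ring
  rw [this]
  exact consQ_congr b (consQ_scale a hb Q)

/-- The reflection in a vector of nonzero value. -/
lemma exists_reflection {M : Type} [AddCommGroup M] [Module K M] (Q : QuadraticForm K M)
    (z : M) (hz : Q z ≠ 0) : ∃ σ : M ≃ₗ[K] M, (∀ x, Q (σ x) = Q x) ∧
      ∀ x, σ x = x - (QuadraticMap.polar Q z x / Q z) • z := by
  let f : M →ₗ[K] M := LinearMap.id - ((Q z)⁻¹ • (QuadraticMap.polarBilin Q z)).smulRight z
  have hf : ∀ x, f x = x - (QuadraticMap.polar Q z x / Q z) • z := by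
    intro x; simp [f, div_eq_inv_mul]
  have hpz : QuadraticMap.polar Q z z = 2 * Q z := by
    rw [QuadraticMap.polar_self]; simp
  have hinv : ∀ x, f (f x) = x := by
    intro x
    have : QuadraticMap.polar Q z (f x) = - QuadraticMap.polar Q z x := by
      rw [hf, QuadraticMap.polar_sub_right, QuadraticMap.polar_smul_right, hpz]
      simp only [smul_eq_mul]; field_simp; ring
    rw [hf (f x), this, hf x]
    module
  refine ⟨LinearEquiv.ofInvolutive f hinv, fun x => ?_, hf⟩
  change Q (f x) = Q x
  rw [hf, sub_eq_add_neg, QuadraticMap.map_add Q, ← neg_smul, QuadraticMap.map_smul,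
    QuadraticMap.polar_smul_right, QuadraticMap.polar_comm Q x z]
  simp only [smul_eq_mul]; field_simp; ring

lemma exists_isometry (h2 : (2 : K) ≠ 0) {M : Type} [AddCommGroup M] [Module K M]
    (Q : QuadraticForm K M)
    (v w : M) (hvw : Q v = Q w) (hv : Q v ≠ 0) : ∃ σ : M ≃ₗ[K] M, (∀ x, Q (σ x) = Q x) ∧
      σ v = w := by
  have hs : Q (v - w) = 2 * Q v - QuadraticMap.polar Q v w := by
    rw [sub_eq_add_neg, QuadraticMap.map_add Q, QuadraticMap.map_neg, QuadraticMap.polar_neg_right,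
      ← hvw]; ring
  have ha : Q (v + w) = 2 * Q v + QuadraticMap.polar Q v w := by
    rw [QuadraticMap.map_add Q, ← hvw]; ring
  have hpz : QuadraticMap.polar Q v v = 2 * Q v := by
    rw [QuadraticMap.polar_self]; simp
  by_cases h : Q (v - w) = 0
  · have h' : Q (v + w) ≠ 0 := by
      intro h'
      have : 2 * 2 * Q v = 0 := by linear_combination h + h' - hs - ha
      simp [h2, hv] at this
    obtain ⟨σ, hσ, e⟩ := exists_reflection Q (v + w) h'
    refine ⟨σ.trans (LinearEquiv.neg K), fun x => by simp [hσ], ?_⟩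
    have : QuadraticMap.polar Q (v + w) v / Q (v + w) = 1 := by
      rw [div_eq_one_iff_eq h', QuadraticMap.polar_add_left, hpz, QuadraticMap.polar_comm Q w v, ha]
    change -(σ v) = w
    rw [e, this]; simp
  · obtain ⟨σ, hσ, e⟩ := exists_reflection Q (v - w) h
    refine ⟨σ, hσ, ?_⟩
    have : QuadraticMap.polar Q (v - w) v / Q (v - w) = 1 := by
      rw [div_eq_one_iff_eq h, QuadraticMap.polar_sub_left, hpz, QuadraticMap.polar_comm Q w v, hs]
    rw [e, this]; simp

lemma cancelQ (h2 : (2 : K) ≠ 0) {n : ℕ} {a : K} (ha : a ≠ 0) {Q Q' : QF K n}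
    (h : QIsom (consQ a Q) (consQ a Q')) : QIsom Q Q' := by
  obtain ⟨φ, hφ⟩ := h
  let e0 : Fin (n + 1) → K := Fin.cons 1 0
  have he : ∀ Q : QF K n, consQ a Q e0 = a := fun Q => by simp [e0, consQ_cons]
  obtain ⟨σ, hσ, hσe⟩ := exists_isometry h2 (consQ a Q') (φ e0) e0 (by rw [hφ, he, he])
    (by rw [hφ, he]; exact ha)
  let ψ := φ.trans σ
  have hψ : ∀ x, consQ a Q' (ψ x) = consQ a Q x := fun x => by simp [ψ, hσ, hφ]
  have hψe : ψ e0 = e0 := hσe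
  have hz : ∀ x, ψ (Fin.cons 0 x) 0 = 0 := by
    intro x
    have h1 : QuadraticMap.polar (consQ a Q') (ψ e0) (ψ (Fin.cons 0 x))
        = QuadraticMap.polar (consQ a Q) e0 (Fin.cons 0 x) := by
      simp only [QuadraticMap.polar, ← map_add, hψ]
    obtain ⟨s, y, hy⟩ := cons_surj (ψ (Fin.cons 0 x))
    rw [hψe, hy, consQ_polar, consQ_polar] at h1
    simp [QuadraticMap.polar, h2, ha] at h1
    rw [hy]; simpa using h1
  let f : (Fin n → K) →ₗ[K] (Fin n → K) :=
    { toFun := fun x => Fin.tail (ψ (Fin.cons 0 x))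
      map_add' := by
        intro x y
        have : (Fin.cons 0 (x + y) : Fin (n + 1) → K) = Fin.cons 0 x + Fin.cons 0 y := by
          rw [cons_add']; simp
        rw [this, map_add]; rfl
      map_smul' := by
        intro c x
        have : (Fin.cons 0 (c • x) : Fin (n + 1) → K) = c • Fin.cons 0 x := by
          ext i; refine Fin.cases ?_ (fun j => ?_) i <;> simp
        rw [this, map_smul]; rfl }
  have hf : ∀ x, ψ (Fin.cons 0 x) = Fin.cons 0 (f x) := by
    intro x
    rw [← Fin.cons_self_tail (ψ (Fin.cons 0 x)), hz]; rfl
  refine qisom_of_injective f ?_ ?_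
  · intro x y hxy
    have := ψ.injective ((hf x).trans ((congrArg _ hxy).trans (hf y).symm))
    exact Fin.cons_right_injective (α := fun _ : Fin (n + 1) => K) 0 this
  · intro x
    have := hψ (Fin.cons 0 x)
    rw [hf, consQ_cons, consQ_cons] at this
    simpa using this

lemma splitQ (h2 : (2 : K) ≠ 0) {n : ℕ} {a : K} (ha : a ≠ 0) {Q : QF K (n + 1)} (hQ : QNondeg Q)
    (v : Fin (n + 1) → K) (hv : Q v = a) : ∃ Q' : QF K n, QNondeg Q' ∧ QIsom Q (consQ a Q') := by
  have hpz : QuadraticMap.polar Q v v = 2 * Q v := by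
    rw [QuadraticMap.polar_self]; simp
  let L : (Fin (n + 1) → K) →ₗ[K] K := QuadraticMap.polarBilin Q v
  have hL : ∀ x, L x = QuadraticMap.polar Q v x := fun x => rfl
  have hLv : L v ≠ 0 := by rw [hL, hpz, hv]; exact mul_ne_zero h2 ha
  have hrank : Module.finrank K (LinearMap.ker L) = n := by
    have h1 := LinearMap.finrank_range_add_finrank_ker L
    have h3 : LinearMap.range L = ⊤ := LinearMap.range_eq_top.2
      (LinearMap.surjective (by intro h; simp [h] at hLv))
    rw [h3] at h1
    simp at h1
    omega
  let e : (Fin n → K) ≃ₗ[K] LinearMap.ker L := LinearEquiv.ofFinrankEq _ _ (by simp [hrank])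
  let f : (Fin (n + 1) → K) →ₗ[K] (Fin (n + 1) → K) :=
    (LinearMap.proj 0).smulRight v + (LinearMap.ker L).subtype ∘ₗ e.toLinearMap ∘ₗ
      LinearMap.funLeft K K Fin.succ
  have hf : ∀ s x, f (Fin.cons s x) = s • v + (e x : Fin (n + 1) → K) := by
    intro s x; simp [f]; rfl
  have hk : ∀ x, L (e x) = 0 := fun x => (e x).2
  have iso : QIsom (consQ a (Q.comp ((LinearMap.ker L).subtype ∘ₗ e.toLinearMap))) Q := by
    refine qisom_of_injective f ?_ ?_
    · rw [← LinearMap.ker_eq_bot, LinearMap.ker_eq_bot']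
      intro x hx
      obtain ⟨s, x, rfl⟩ := cons_surj x
      rw [hf] at hx
      have hs : s = 0 := by
        have := congrArg L hx
        rw [map_add, map_smul, hk] at this
        simpa [hLv] using this
      rw [hs] at hx
      have hx0 : x = 0 := by simpa using hx
      subst hs hx0
      ext i; refine Fin.cases ?_ (fun j => ?_) i <;> simp
    · intro x
      obtain ⟨s, x, rfl⟩ := cons_surj x
      rw [hf, consQ_cons, QuadraticMap.map_add Q, QuadraticMap.map_smul,
        QuadraticMap.polar_smul_left, ← hL, hk, hv]
      simp; ring
  exact ⟨_, (consQ_nondeg_iff h2 ha _).1 (iso.symm'.nondeg hQ), iso.symm'⟩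

lemma exists_ne_zero {n : ℕ} {Q : QF K (n + 1)} (hQ : QNondeg Q) : ∃ v, Q v ≠ 0 := by
  by_contra! h
  have := hQ (fun _ => 1) (fun w => by simp [QuadraticMap.polar, h])
  simpa using congrFun this 0

end QFpart

section Count

variable {K : Type} [Field K]

/-- The form represents `1`. -/
def Rep1 {n : ℕ} (Q : QF K n) : Prop := ∃ v, Q v = 1

lemma Rep1.of_isom {n : ℕ} {Q Q' : QF K n} (h : QIsom Q Q') (hr : Rep1 Q) : Rep1 Q' := by
  obtain ⟨φ, hφ⟩ := h
  obtain ⟨v, hv⟩ := hr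
  exact ⟨φ v, by rw [hφ, hv]⟩

lemma Rep1.cons {n : ℕ} {Q : QF K n} (a : K) (hr : Rep1 Q) : Rep1 (consQ a Q) := by
  obtain ⟨v, hv⟩ := hr
  exact ⟨Fin.cons 0 v, by rw [consQ_cons, hv]; ring⟩

/-- A complete irredundant family of representatives of nondegenerate forms. -/
def HasReps (K : Type) [Field K] (n : ℕ) (ι : Type) : Prop :=
  ∃ f : ι → QF K n, (∀ i, QNondeg (f i)) ∧ (∀ i j, QIsom (f i) (f j) → i = j) ∧
    ∀ Q : QF K n, QNondeg Q → ∃ i, QIsom Q (f i)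

/-- A complete irredundant family of representatives of nondegenerate forms
which do not represent `1`. -/
def HasE (K : Type) [Field K] (n : ℕ) (ι : Type) : Prop :=
  ∃ f : ι → QF K n, (∀ i, QNondeg (f i)) ∧ (∀ i, ¬ Rep1 (f i)) ∧
    (∀ i j, QIsom (f i) (f j) → i = j) ∧ ∀ Q : QF K n, QNondeg Q → ¬ Rep1 Q → ∃ i, QIsom Q (f i)

lemma HasReps.step (h2 : (2 : K) ≠ 0) {n : ℕ} {ι κ : Type} (h : HasReps K n ι)
    (h' : HasE K (n + 1) κ) : HasReps K (n + 1) (ι ⊕ κ) := by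
  obtain ⟨f, hf1, hf2, hf3⟩ := h
  obtain ⟨g, hg1, hg4, hg2, hg3⟩ := h'
  have hr : ∀ i, Rep1 (consQ 1 (f i)) := fun i => ⟨Fin.cons 1 0, by rw [consQ_cons]; simp⟩
  refine ⟨Sum.elim (fun i => consQ 1 (f i)) g, ?_, ?_, ?_⟩
  · rintro (i | i)
    · exact (consQ_nondeg_iff h2 one_ne_zero _).2 (hf1 i)
    · exact hg1 i
  · rintro (i | i) (j | j) hij
    · rw [hf2 i j (cancelQ h2 one_ne_zero hij)]
    · exact absurd ((hr i).of_isom hij) (hg4 j)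
    · exact absurd ((hr j).of_isom hij.symm') (hg4 i)
    · rw [hg2 i j hij]
  · intro Q hQ
    by_cases h : Rep1 Q
    · obtain ⟨v, hv⟩ := h
      obtain ⟨Q', hQ', iso⟩ := splitQ h2 one_ne_zero hQ v hv
      obtain ⟨i, hi⟩ := hf3 Q' hQ'
      exact ⟨Sum.inl i, iso.trans' (consQ_congr 1 hi)⟩
    · obtain ⟨i, hi⟩ := hg3 Q hQ h
      exact ⟨Sum.inr i, hi⟩

lemma HasReps.zero : HasReps K 0 Unit := by
  refine ⟨fun _ => 0, fun _ v _ => Subsingleton.elim _ _, fun _ _ _ => rfl, fun Q _ => ⟨(), ?_⟩⟩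
  refine ⟨LinearEquiv.refl K _, fun x => ?_⟩
  have : x = 0 := Subsingleton.elim _ _
  rw [this, map_zero, QuadraticMap.map_zero, QuadraticMap.map_zero]

lemma HasReps.card {n : ℕ} {ι : Type} (h : HasReps K n ι) :
    Nat.card (Quot (fun (Q Q' : {Q : QF K n // QNondeg Q}) => QIsom Q.1 Q'.1)) = Nat.card ι := by
  obtain ⟨f, hf1, hf2, hf3⟩ := h
  have heq : Equivalence (fun (Q Q' : {Q : QF K n // QNondeg Q}) => QIsom Q.1 Q'.1) :=
    ⟨fun Q => QIsom.refl' _, fun h => h.symm', fun h h' => h.trans' h'⟩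
  symm
  refine Nat.card_congr (Equiv.ofBijective (fun i => Quot.mk _ ⟨f i, hf1 i⟩) ⟨?_, ?_⟩)
  · intro i j hij
    exact hf2 i j (heq.eqvGen_iff.1 (Quot.eqvGen_exact hij))
  · intro q
    obtain ⟨⟨Q, hQ⟩, rfl⟩ := Quot.exists_rep q
    obtain ⟨i, hi⟩ := hf3 Q hQ
    exact ⟨i, Quot.sound hi.symm'⟩

variable {u π : K}

lemma LocData.u0 (d : LocData K u π) : u ≠ 0 := by
  intro h
  have := d.aniso 0 1 0 0 (by rw [h]; ring)
  exact one_ne_zero this.2.1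

lemma LocData.p0 (d : LocData K u π) : π ≠ 0 := by
  intro h
  have := d.aniso 0 0 1 0 (by rw [h]; ring)
  exact one_ne_zero this.2.2.1

lemma LocData.norm_u (d : LocData K u π) : ∃ x y : K, x ^ 2 - u * y ^ 2 = u := by
  obtain ⟨t, ht | ht⟩ := d.neg_one
  · exact ⟨0, t, by linear_combination u * ht⟩
  · obtain ⟨a, b, h⟩ := d.sum_sq
    exact ⟨a, t * b, by linear_combination h + b ^ 2 * ht⟩

lemma LocData.diffsq (d : LocData K u π) (m : K) : ∃ x y : K, x ^ 2 - y ^ 2 = m := by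
  have := d.two
  exact ⟨(m + 1) / 2, (m - 1) / 2, by field_simp; ring⟩

lemma LocData.uu (d : LocData K u π) : ∃ x y : K, u * x ^ 2 + u * y ^ 2 = 1 := by
  obtain ⟨a, b, h⟩ := d.sum_sq
  have := d.u0
  exact ⟨a / u, b / u, by field_simp; exact h⟩

lemma LocData.neg_class (d : LocData K u π) {β δ : K} (hβ : β = 1 ∨ β = u) (hδ : δ = 1 ∨ δ = u) :
    ∃ t, -δ = β * t ^ 2 ∨ -δ = β * (u * t ^ 2) := by
  have hu := d.u0
  obtain ⟨t, ht⟩ := d.neg_one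
  rcases hβ with rfl | rfl <;> rcases hδ with rfl | rfl
  · exact ⟨t, by simpa using ht⟩
  · rcases ht with h | h
    · exact ⟨t, Or.inr (by linear_combination δ * h)⟩
    · exact ⟨δ * t, Or.inl (by linear_combination δ * h)⟩
  · rcases ht with h | h
    · exact ⟨t / β, Or.inr (by field_simp; linear_combination h)⟩
    · exact ⟨t, Or.inl h⟩
  · rcases ht with h | h
    · exact ⟨t, Or.inl (by linear_combination δ * h)⟩
    · exact ⟨t, Or.inr (by linear_combination δ * h)⟩

lemma LocData.three_eq (d : LocData K u π) {β δ : K} (hβ : β = 1 ∨ β = u) (hδ : δ = 1 ∨ δ = u) :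
    ∃ x y z : K, β * π * x ^ 2 + β * π * y ^ 2 + δ * π * z ^ 2 = 1 := by
  have hp := d.p0
  have hδ0 : δ ≠ 0 := by rcases hδ with rfl | rfl; exacts [one_ne_zero, d.u0]
  have h : ∃ x y : K, β * (x ^ 2 + y ^ 2) = -δ := by
    obtain ⟨t, h | h⟩ := d.neg_class hβ hδ
    · exact ⟨t, 0, by rw [h]; ring⟩
    · obtain ⟨a, b, hab⟩ := d.sum_sq
      exact ⟨a * t, b * t, by linear_combination t ^ 2 * β * hab - h⟩
  obtain ⟨x, y, hxy⟩ := h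
  obtain ⟨z, s, hzs⟩ := d.diffsq (1 / (δ * π))
  refine ⟨s * x, s * y, z, ?_⟩
  have : δ * π * (z ^ 2 - s ^ 2) = 1 := by rw [hzs]; field_simp
  linear_combination this + π * s ^ 2 * hxy

lemma LocData.three (d : LocData K u π) {b c e : K} (hb : b = π ∨ b = u * π)
    (hc : c = π ∨ c = u * π) (he : e = π ∨ e = u * π) :
    ∃ x y z : K, b * x ^ 2 + c * y ^ 2 + e * z ^ 2 = 1 := by
  have fac : ∀ {b : K}, (b = π ∨ b = u * π) → ∃ β, (β = 1 ∨ β = u) ∧ b = β * π := by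
    rintro b (rfl | rfl)
    · exact ⟨1, Or.inl rfl, by ring⟩
    · exact ⟨u, Or.inr rfl, rfl⟩
  obtain ⟨β, hβ, rfl⟩ := fac hb
  obtain ⟨γ, hγ, rfl⟩ := fac hc
  obtain ⟨δ, hδ, rfl⟩ := fac he
  by_cases h1 : β = γ
  · subst h1; exact d.three_eq hβ hδ
  by_cases h2 : β = δ
  · subst h2
    obtain ⟨x, y, z, h⟩ := d.three_eq hβ hγ
    exact ⟨x, z, y, by linear_combination h⟩
  have h3 : γ = δ := by
    rcases hβ with rfl | rfl <;> rcases hγ with rfl | rfl <;> rcases hδ with rfl | rfl <;>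
      simp_all
  subst h3
  obtain ⟨x, y, z, h⟩ := d.three_eq hγ hβ
  exact ⟨z, x, y, by linear_combination h⟩

lemma LocData.pair (d : LocData K u π) {b c : K} (hb : b = π ∨ b = u * π)
    (hc : c = π ∨ c = u * π) {n : ℕ} (Q : QF K n) (hr : ¬ Rep1 (consQ b (consQ c Q))) :
    QIsom (consQ b (consQ c Q)) (consQ π (consQ (-(u * π)) Q)) := by
  have hp := d.p0
  have hu := d.u0
  have hr' : ∀ x y : K, b * x ^ 2 + c * y ^ 2 ≠ 1 := fun x y h =>
    hr ⟨Fin.cons x (Fin.cons y 0), by rw [consQ_cons, consQ_cons]; simp [h]⟩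
  have fac : ∀ {b : K}, (b = π ∨ b = u * π) → ∃ β, (β = 1 ∨ β = u) ∧ b = β * π := by
    rintro b (rfl | rfl)
    · exact ⟨1, Or.inl rfl, by ring⟩
    · exact ⟨u, Or.inr rfl, rfl⟩
  obtain ⟨β, hβ, rfl⟩ := fac hb
  obtain ⟨γ, hγ, rfl⟩ := fac hc
  have hβ0 : β ≠ 0 := by rcases hβ with rfl | rfl; exacts [one_ne_zero, hu]
  have hγ0 : γ ≠ 0 := by rcases hγ with rfl | rfl; exacts [one_ne_zero, hu]
  obtain ⟨t, h | h⟩ := d.neg_class hβ hγ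
  · exfalso
    obtain ⟨x, y, hxy⟩ := d.diffsq (1 / (β * π))
    apply hr' x (y / t)
    have ht : t ≠ 0 := by
      rintro rfl
      apply hγ0
      linear_combination -h
    have h1 : β * π * (x ^ 2 - y ^ 2) = 1 := by rw [hxy]; field_simp
    have h3 : γ = -(β * t ^ 2) := by linear_combination -h
    rw [← h1, h3]; field_simp; ring
  · have ht : t ≠ 0 := by
      rintro rfl
      apply hγ0
      linear_combination -h
    have hone : ∃ x y : K, β * x ^ 2 + γ * y ^ 2 = 1 := by
      rcases hβ with rfl | rfl
      · exact ⟨1, 0, by ring⟩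
      rcases hγ with rfl | rfl
      · exact ⟨0, 1, by ring⟩
      exact d.uu
    obtain ⟨x, y, hxy⟩ := hone
    refine (binary (x := x) (y := y) (e := π) (by linear_combination π * hxy) hp Q).trans' ?_
    have : β * π * (γ * π) * π = -(u * π) * (β * π * t) ^ 2 := by
      linear_combination -(β * π ^ 3 * h)
    rw [this]
    exact consQ_congr _ (consQ_scale _ (by positivity) _)

lemma LocData.splitN (d : LocData K u π) {n : ℕ} {Q : QF K (n + 1)} (hQ : QNondeg Q)
    (hr : ¬ Rep1 Q) : ∃ a : K, (a = u ∨ a = π ∨ a = u * π) ∧ ∃ Q' : QF K n, QNondeg Q' ∧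
      ¬ Rep1 Q' ∧ QIsom Q (consQ a Q') := by
  have hp := d.p0
  have hu := d.u0
  obtain ⟨v, hv⟩ := exists_ne_zero hQ
  obtain ⟨t, ht, h⟩ := d.cov _ hv
  have key : ∀ a : K, Q v = a * t ^ 2 → Q (t⁻¹ • v) = a := by
    intro a ha
    rw [QuadraticMap.map_smul, ha, smul_eq_mul]; field_simp
  have fin : ∀ a : K, a ≠ 0 → Q v = a * t ^ 2 → ∃ Q' : QF K n, QNondeg Q' ∧
      ¬ Rep1 Q' ∧ QIsom Q (consQ a Q') := by
    intro a ha0 ha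
    obtain ⟨Q', h1, h2⟩ := splitQ d.two ha0 hQ _ (key a ha)
    exact ⟨Q', h1, fun h => hr ((h.cons a).of_isom h2.symm'), h2⟩
  rcases h with h | h | h | h
  · exact absurd ⟨_, key 1 (by rw [h]; ring)⟩ hr
  · exact ⟨u, by simp, fin u hu h⟩
  · exact ⟨π, by simp, fin π hp h⟩
  · exact ⟨u * π, by simp, fin (u * π) (by positivity) h⟩

lemma LocData.not_uu (d : LocData K u π) {n : ℕ} (Q : QF K n) : Rep1 (consQ u (consQ u Q)) := by
  obtain ⟨x, y, h⟩ := d.uu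
  exact ⟨Fin.cons x (Fin.cons y 0), by rw [consQ_cons, consQ_cons]; simp [h]⟩

lemma LocData.not_ppp (d : LocData K u π) {b c e : K} (hb : b = π ∨ b = u * π)
    (hc : c = π ∨ c = u * π) (he : e = π ∨ e = u * π) {n : ℕ} (Q : QF K n) :
    Rep1 (consQ b (consQ c (consQ e Q))) := by
  obtain ⟨x, y, z, h⟩ := d.three hb hc he
  exact ⟨Fin.cons x (Fin.cons y (Fin.cons z 0)), by
    rw [consQ_cons, consQ_cons, consQ_cons]; simp [← add_assoc, h]⟩

lemma isom_one {a b : K} {Q Q' : QF K 0} (h : QIsom (consQ a Q) (consQ b Q')) :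
    ∃ t, a = b * t ^ 2 := by
  obtain ⟨φ, hφ⟩ := h
  have h := hφ (Fin.cons 1 0)
  obtain ⟨s, y, hy⟩ := cons_surj (φ (Fin.cons 1 0))
  have hy0 : y = 0 := Subsingleton.elim _ _
  rw [hy, consQ_cons, consQ_cons, hy0, QuadraticMap.map_zero, QuadraticMap.map_zero] at h
  exact ⟨s, by linear_combination -h⟩

lemma nondeg_zero (Q : QF K 0) : QNondeg Q := fun _ _ => Subsingleton.elim _ _

lemma qf_zero (Q : QF K 0) : Q = 0 := by
  ext x
  have : x = 0 := Subsingleton.elim _ _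
  rw [this, QuadraticMap.map_zero, QuadraticMap.map_zero]

lemma LocData.not_sq_u (d : LocData K u π) (t : K) : u ≠ t ^ 2 := fun h =>
  one_ne_zero (d.aniso t 1 0 0 (by rw [← h]; ring)).2.1

lemma LocData.not_sq_p (d : LocData K u π) (t : K) : π * t ^ 2 ≠ 1 := fun h =>
  one_ne_zero (d.aniso 1 0 t 0 (by linear_combination -h)).1

lemma LocData.u_ne (d : LocData K u π) (x y : K) : u ≠ π * (x ^ 2 - u * y ^ 2) := by
  intro h
  obtain ⟨a, b, hab⟩ := d.norm_u
  obtain ⟨h1, h2, -⟩ := d.aniso a b x y (by rw [hab]; exact h)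
  apply d.u0
  rw [← hab, h1, h2]; ring

lemma LocData.E1 (d : LocData K u π) : HasE K 1 (Fin 3) := by
  have hp := d.p0
  have hu := d.u0
  have ne1 : ∀ t, u ≠ π * t ^ 2 := fun t h => d.u_ne t 0 (by rw [h]; ring)
  have ne2 : ∀ t, u ≠ u * π * t ^ 2 := fun t h => d.not_sq_p t
    (mul_left_cancel₀ hu (by linear_combination -h))
  have ne3 : ∀ t, π ≠ u * π * t ^ 2 := fun t h => d.not_sq_u (u * t)
    (mul_left_cancel₀ hp (by linear_combination u * h))
  have inv : ∀ a b t : K, a ≠ 0 → a = b * t ^ 2 → b = a * (t⁻¹) ^ 2 := by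
    intro a b t ha h
    have : t ≠ 0 := by rintro rfl; apply ha; rw [h]; ring
    rw [h]; field_simp
  refine ⟨fun i => consQ (![u, π, u * π] i) 0, ?_, ?_, ?_, ?_⟩
  · intro i
    refine (consQ_nondeg_iff d.two ?_ _).2 (nondeg_zero _)
    fin_cases i <;> simp [hp, hu]
  · rintro i ⟨v, hv⟩
    rw [consQ_apply] at hv
    simp only [QuadraticMap.zero_apply, add_zero] at hv
    generalize v 0 = t at hv
    have ht : t ≠ 0 := by rintro rfl; simp at hv
    fin_cases i
    · exact d.not_sq_u (u * t) (by simp at hv; linear_combination -u * hv)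
    · exact d.not_sq_p t hv
    · exact ne1 (u * t) (by simp at hv; linear_combination -u * hv)
  · intro i j hij
    obtain ⟨t, ht⟩ := isom_one hij
    fin_cases i <;> fin_cases j <;> simp at ht ⊢
    · exact ne1 _ ht
    · exact ne2 _ ht
    · exact ne1 _ (inv _ _ _ hp ht)
    · exact ne3 _ ht
    · have h : π = t ^ 2 := ht.resolve_right hu
      exact ne2 _ (inv (u * π) u t (by positivity) (by linear_combination u * h))
    · exact ne3 _ (inv _ _ _ (by positivity) ht)
  · intro Q hQ hr
    obtain ⟨a, ha, Q', -, -, iso⟩ := d.splitN hQ hr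
    rw [qf_zero Q'] at iso
    rcases ha with rfl | rfl | rfl
    · exact ⟨0, iso⟩
    · exact ⟨1, iso⟩
    · exact ⟨2, iso⟩

lemma LocData.E2 (d : LocData K u π) : HasE K 2 (Fin 3) := by
  have hp := d.p0
  have hu := d.u0
  have hup : u * π ≠ 0 := mul_ne_zero hu hp
  have g2 : ∀ x y : K, π * x ^ 2 + -(u * π) * y ^ 2 ≠ u := fun x y h =>
    d.u_ne x y (by linear_combination -h)
  have rep2 : ∀ a b e : K, ∀ Q : QF K 0, QIsom (consQ e (consQ a Q)) (consQ π (consQ b Q)) →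
      ∃ x y : K, π * x ^ 2 + b * y ^ 2 = e := by
    rintro a b e Q ⟨φ, hφ⟩
    have h := hφ (Fin.cons 1 0)
    obtain ⟨s, y, hy⟩ := cons_surj (φ (Fin.cons 1 0))
    obtain ⟨s', y', rfl⟩ := cons_surj y
    have hy0 : y' = 0 := Subsingleton.elim _ _
    rw [hy, consQ_cons, consQ_cons, consQ_cons, hy0, QuadraticMap.map_zero,
      QuadraticMap.map_zero] at h
    exact ⟨s, s', by linear_combination h⟩
  refine ⟨fun i => consQ (![u, u, π] i) (consQ (![π, u * π, -(u * π)] i) 0), ?_, ?_, ?_, ?_⟩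
  · intro i
    refine (consQ_nondeg_iff d.two ?_ _).2 ((consQ_nondeg_iff d.two ?_ _).2 (nondeg_zero _)) <;>
    fin_cases i <;> simp [hp, hu]
  · rintro i ⟨v, hv⟩
    rw [consQ_apply, consQ_apply] at hv
    simp only [QuadraticMap.zero_apply, add_zero] at hv
    generalize v 0 = x at hv
    generalize v _ = y at hv
    fin_cases i
    · simp at hv
      exact one_ne_zero (d.aniso 1 x y 0 (by linear_combination -hv)).1
    · simp at hv
      obtain ⟨a, b, hab⟩ := d.norm_u
      exact one_ne_zero (d.aniso 1 x (a * y) (b * y)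
        (by linear_combination -hv - π * y ^ 2 * hab)).1
    · simp at hv
      exact one_ne_zero (d.aniso 1 0 x y (by linear_combination -hv)).1
  · intro i j hij
    have c01 : ¬ QIsom (consQ u (consQ π (0 : QF K 0))) (consQ u (consQ (u * π) (0 : QF K 0))) := by
      intro h
      obtain ⟨t, ht⟩ := isom_one (cancelQ d.two hu h)
      exact d.not_sq_u (u * t) (mul_left_cancel₀ hp (by linear_combination u * ht))
    have c2 : ∀ a, ¬ QIsom (consQ u (consQ a (0 : QF K 0)))
        (consQ π (consQ (-(u * π)) (0 : QF K 0))) := by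
      intro a h
      obtain ⟨x, y, h⟩ := rep2 _ _ _ _ h
      exact g2 x y h
    fin_cases i <;> fin_cases j <;> simp at hij ⊢
    · exact c01 hij
    · exact c2 _ hij
    · exact c01 hij.symm'
    · exact c2 _ hij
    · exact c2 _ hij.symm'
    · exact c2 _ hij.symm'
  · intro Q hQ hr
    obtain ⟨a, ha, Q', hQ', hr', iso⟩ := d.splitN hQ hr
    obtain ⟨b, hb, Q'', -, -, iso'⟩ := d.splitN hQ' hr'
    rw [qf_zero Q''] at iso'
    have iso2 := iso.trans' (consQ_congr a iso')
    have hr2 : ¬ Rep1 (consQ a (consQ b (0 : QF K 0))) := fun h => hr (h.of_isom iso2.symm')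
    rcases ha with rfl | ha
    · rcases hb with rfl | rfl | rfl
      · exact absurd (d.not_uu _) hr2
      · exact ⟨0, iso2⟩
      · exact ⟨1, iso2⟩
    · rcases hb with rfl | hb
      · rcases ha with rfl | rfl
        · exact ⟨0, iso2.trans' (swapQ hp hu _)⟩
        · exact ⟨1, iso2.trans' (swapQ hup hu _)⟩
      · exact ⟨2, iso2.trans' (d.pair ha hb _ hr2)⟩

/-- A ternary form not representing `1`, plus possibly more. -/
lemma LocData.tern (d : LocData K u π) {n : ℕ} {Q : QF K (n + 3)} (hQ : QNondeg Q)
    (hr : ¬ Rep1 Q) : ∃ Q' : QF K n, QNondeg Q' ∧ ¬ Rep1 Q' ∧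
      QIsom Q (consQ u (consQ π (consQ (-(u * π)) Q'))) ∧
      ∃ b c, (b = π ∨ b = u * π) ∧ (c = π ∨ c = u * π) ∧
      QIsom Q (consQ u (consQ b (consQ c Q'))) := by
  have hp := d.p0
  have hu := d.u0
  have hup : u * π ≠ 0 := mul_ne_zero hu hp
  have hP : ∀ {b : K}, (b = π ∨ b = u * π) → b ≠ 0 := by rintro b (rfl | rfl) <;> assumption
  obtain ⟨a, ha, Q1, hQ1, hr1, iso1⟩ := d.splitN hQ hr
  obtain ⟨b, hb, Q2, hQ2, hr2, iso2⟩ := d.splitN hQ1 hr1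
  obtain ⟨c, hc, Q3, hQ3, hr3, iso3⟩ := d.splitN hQ2 hr2
  have iso := iso1.trans' (consQ_congr a (iso2.trans' (consQ_congr b iso3)))
  refine ⟨Q3, hQ3, hr3, ?_⟩
  have fin : ∀ b c : K, (b = π ∨ b = u * π) → (c = π ∨ c = u * π) →
      QIsom Q (consQ u (consQ b (consQ c Q3))) →
      (QIsom Q (consQ u (consQ π (consQ (-(u * π)) Q3))) ∧
      ∃ b c, (b = π ∨ b = u * π) ∧ (c = π ∨ c = u * π) ∧
      QIsom Q (consQ u (consQ b (consQ c Q3)))) := by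
    intro b c hb hc iso
    refine ⟨iso.trans' (consQ_congr u (d.pair hb hc _ fun h => ?_)), b, c, hb, hc, iso⟩
    exact hr ((h.cons u).of_isom iso.symm')
  have no : ∀ {Q' : QF K (n + 3)}, QIsom Q Q' → ¬ Rep1 Q' := fun iso h => hr (h.of_isom iso.symm')
  rcases ha with rfl | ha
  · rcases hb with rfl | hb
    · exact absurd (d.not_uu _) (no iso)
    rcases hc with rfl | hc
    · exact absurd (d.not_uu _) (no (iso.trans' (consQ_congr _ (swapQ (hP hb) hu _))))
    · exact fin b c hb hc iso
  · rcases hb with rfl | hb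
    · have iso := iso.trans' (swapQ (hP ha) hu _)
      rcases hc with rfl | hc
      · exact absurd (d.not_uu _) (no (iso.trans' (consQ_congr _ (swapQ (hP ha) hu _))))
      · exact fin a c ha hc iso
    · rcases hc with rfl | hc
      · exact fin a b ha hb ((iso.trans' (consQ_congr a (swapQ (hP hb) hu _))).trans'
          (swapQ (hP ha) hu _))
      · exact absurd (d.not_ppp ha hb hc _) (no iso)

lemma LocData.E3 (d : LocData K u π) : HasE K 3 Unit := by
  have hp := d.p0
  have hu := d.u0
  refine ⟨fun _ => consQ u (consQ π (consQ (-(u * π)) 0)), ?_, ?_, fun _ _ _ => rfl, ?_⟩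
  · intro _
    refine (consQ_nondeg_iff d.two hu _).2 ((consQ_nondeg_iff d.two hp _).2
      ((consQ_nondeg_iff d.two ?_ _).2 (nondeg_zero _)))
    simp [hp, hu]
  · rintro _ ⟨v, hv⟩
    obtain ⟨x, v, rfl⟩ := cons_surj v
    obtain ⟨y, v, rfl⟩ := cons_surj v
    obtain ⟨z, v, rfl⟩ := cons_surj v
    rw [consQ_cons, consQ_cons, consQ_cons] at hv
    simp only [QuadraticMap.zero_apply, add_zero] at hv
    exact one_ne_zero (d.aniso 1 x y z (by linear_combination -hv)).1
  · intro Q hQ hr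
    obtain ⟨Q', -, -, iso, -⟩ := d.tern hQ hr
    rw [qf_zero Q'] at iso
    exact ⟨(), iso⟩

lemma LocData.E4 (d : LocData K u π) (n : ℕ) : HasE K (n + 4) Empty := by
  have hp := d.p0
  have hu := d.u0
  have hup : u * π ≠ 0 := mul_ne_zero hu hp
  have hP : ∀ {b : K}, (b = π ∨ b = u * π) → b ≠ 0 := by rintro b (rfl | rfl) <;> assumption
  refine ⟨fun i => i.elim, fun i => i.elim, fun i => i.elim, fun i => i.elim, ?_⟩
  intro Q hQ hr
  exfalso
  obtain ⟨Q', hQ', hr', -, b, c, hb, hc, iso⟩ := d.tern (n := n + 1) hQ hr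
  obtain ⟨e, he, Q'', -, -, iso'⟩ := d.splitN hQ' hr'
  have iso2 := iso.trans' (consQ_congr u (consQ_congr b (consQ_congr c iso')))
  rcases he with rfl | he
  · exact hr ((d.not_uu _).of_isom (iso2.trans' (consQ_congr e ((consQ_congr b
      (swapQ (hP hc) hu _)).trans' (swapQ (hP hb) hu _)))).symm')
  · exact hr (((d.not_ppp hb hc he _).cons u).of_isom iso2.symm')

lemma LocData.R1 (d : LocData K u π) : HasReps K 1 (Unit ⊕ Fin 3) := HasReps.zero.step d.two d.E1

lemma LocData.R2 (d : LocData K u π) : HasReps K 2 ((Unit ⊕ Fin 3) ⊕ Fin 3) :=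
  d.R1.step d.two d.E2

lemma LocData.R3 (d : LocData K u π) (n : ℕ) :
    ∃ ι : Type, Nat.card ι = 8 ∧ HasReps K (n + 3) ι := by
  induction n with
  | zero => exact ⟨_, by simp, d.R2.step d.two d.E3⟩
  | succ n ih =>
    obtain ⟨ι, hι, h⟩ := ih
    refine ⟨ι ⊕ Empty, ?_, h.step d.two (d.E4 n)⟩
    rw [← hι]
    exact Nat.card_congr (Equiv.sumEmpty ι Empty)

end Count

/-- The number of isometry classes of nondegenerate quadratic forms of degree `n` over a
finite extension of `ℚ_p` (`p` odd) is `4` if `n = 1`, `7` if `n = 2`, and `8` if `n ≥ 3`. -/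
theorem statement_9 (p : ℕ) [Fact p.Prime] (hp : p ≠ 2) (K : Type) [Field K]
    [Algebra ℚ_[p] K] [FiniteDimensional ℚ_[p] K]
    (n : ℕ) (N : ℕ)
    (hN : N = Nat.card (Quot (fun (Q Q' : {Q : QF K n // QNondeg Q}) => QIsom Q.1 Q'.1))) :
    (n = 1 → N = 4) ∧ (n = 2 → N = 7) ∧ (3 ≤ n → N = 8) := by
  obtain ⟨u, π, d⟩ := locData_padic p hp K
  refine ⟨?_, ?_, ?_⟩
  · rintro rfl
    rw [hN, d.R1.card]; simp
  · rintro rfl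
    rw [hN, d.R2.card]; simp
  · intro h
    obtain ⟨m, rfl⟩ := Nat.exists_eq_add_of_le' h
    obtain ⟨ι, hι, h⟩ := d.R3 m
    rw [hN, h.card, hι]
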